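/- Let $d\ge 1$ and $\alpha\in(0,\min(2,d))$. There exists a constant $C>0$, depending only on $d$ and $\alpha$, such that for all $0\le t\le t'$: $\sup_{x\in Q}\int_t^{t'} \|G_d(t'-s,x,\cdot)\|_{(\alpha)}^2\, ds \le C\, (t'-t)^{1-\alpha/2}$. -/

import Mathlib

open MeasureTheory

/-- `φ_j(ξ) = √2 sin(jπξ)`. -/
noncomputable def phiF (j : ℕ) (ξ : ℝ) : ℝ := Real.sqrt 2 * Real.sin ((j : ℝ) * Real.pi * ξ)

/-- Green function of the heat operator on `[0,1]` with homogeneous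
Dirichlet boundary conditions: `G(t,x,y) = ∑_{j≥1} e^{-j²π²t} φ_j(x) φ_j(y)`. -/
noncomputable def G (t x y : ℝ) : ℝ :=
  ∑' j : ℕ, Real.exp (-((j : ℝ) + 1) ^ 2 * Real.pi ^ 2 * t) * phiF (j + 1) x * phiF (j + 1) y

/-- The cube `Q = [0,1]^d`. -/
def Q (d : ℕ) : Set (EuclideanSpace ℝ (Fin d)) := {x | ∀ i, x i ∈ Set.Icc (0 : ℝ) 1}

/-- `G_d(t,x,y) = ∏_i G(t,x_i,y_i)` on `Q = [0,1]^d`. -/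
noncomputable def Gd (d : ℕ) (t : ℝ) (x y : EuclideanSpace ℝ (Fin d)) : ℝ :=
  ∏ i, G t (x i) (y i)

/-- `‖φ‖_{(α)}² = ∫_Q ∫_Q |φ(y)| |y-z|^{-α} |φ(z)| dy dz`. -/
noncomputable def normAlphaSq (d : ℕ) (α : ℝ) (f : EuclideanSpace ℝ (Fin d) → ℝ) : ℝ :=
  ∫ y in Q d, ∫ z in Q d, |f y| * ‖y - z‖ ^ (-α) * |f z|

noncomputable def Eexp (t : ℝ) (j : ℕ) : ℝ := Real.exp (-((j : ℝ) + 1) ^ 2 * Real.pi ^ 2 * t)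

lemma Eexp_partial {t : ℝ} (ht : 0 < t) (n : ℕ) :
    ∑ i ∈ Finset.range n, Eexp t i ≤ t ^ (-(1/2 : ℝ)) := by
  have hb : 0 < Real.pi ^ 2 * t := by positivity
  have hanti : AntitoneOn (fun x : ℝ => Real.exp (-(Real.pi ^ 2 * t) * x ^ 2))
      (Set.Icc (0:ℝ) (0 + n)) := by
    intro a ha b hb' hab
    have h0 : 0 ≤ a := ha.1
    apply Real.exp_le_exp.mpr
    have : a ^ 2 ≤ b ^ 2 := by gcongr
    nlinarith
  have h1 := hanti.sum_le_integral
  have h2 : ∑ i ∈ Finset.range n, Eexp t i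
      = ∑ i ∈ Finset.range n, Real.exp (-(Real.pi ^ 2 * t) * (0 + ((i + 1 : ℕ) : ℝ)) ^ 2) := by
    refine Finset.sum_congr rfl fun i _ => ?_
    unfold Eexp
    congr 1
    push_cast
    ring
  rw [h2]
  refine h1.trans ?_
  rw [intervalIntegral.integral_of_le (by positivity)]
  refine (setIntegral_le_integral (integrable_exp_neg_mul_sq hb)
    (Filter.Eventually.of_forall fun x => (Real.exp_pos _).le)).trans ?_
  rw [integral_gaussian, Real.rpow_neg ht.le, ← Real.sqrt_eq_rpow, ← Real.sqrt_inv]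
  apply Real.sqrt_le_sqrt
  have : Real.pi / (Real.pi ^ 2 * t) = Real.pi⁻¹ * t⁻¹ := by
    field_simp
  rw [this]
  have hpi : Real.pi⁻¹ ≤ 1 := inv_le_one_of_one_le₀ (by linarith [Real.pi_gt_three])
  have : 0 < t⁻¹ := by positivity
  nlinarith

lemma Eexp_nonneg (t : ℝ) (j : ℕ) : 0 ≤ Eexp t j := (Real.exp_pos _).le

lemma Eexp_summable {t : ℝ} (ht : 0 < t) : Summable (Eexp t) :=
  summable_of_sum_range_le (Eexp_nonneg t) (Eexp_partial ht)

lemma Eexp_tsum {t : ℝ} (ht : 0 < t) : ∑' j, Eexp t j ≤ t ^ (-(1/2 : ℝ)) :=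
  Real.tsum_le_of_sum_range_le (Eexp_nonneg t) (Eexp_partial ht)

lemma phiF_mul (j : ℕ) (x y : ℝ) : phiF j x * phiF j y
    = 2 * (Real.sin (j * Real.pi * x) * Real.sin (j * Real.pi * y)) := by
  unfold phiF
  have : Real.sqrt 2 * Real.sqrt 2 = 2 := Real.mul_self_sqrt (by norm_num)
  linear_combination (Real.sin (j * Real.pi * x) * Real.sin (j * Real.pi * y)) * this

lemma term_bound (t x y : ℝ) (j : ℕ) :
    ‖Real.exp (-((j : ℝ) + 1) ^ 2 * Real.pi ^ 2 * t) * phiF (j + 1) x * phiF (j + 1) y‖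
      ≤ 2 * Eexp t j := by
  rw [mul_assoc, phiF_mul, norm_mul, norm_mul, norm_mul, Real.norm_of_nonneg (Real.exp_pos _).le,
    Real.norm_of_nonneg (by norm_num : (0:ℝ) ≤ 2)]
  have h := mul_le_one₀ (Real.abs_sin_le_one (((j+1 : ℕ):ℝ) * Real.pi * x)) (abs_nonneg _)
    (Real.abs_sin_le_one (((j+1 : ℕ):ℝ) * Real.pi * y))
  simp only [Real.norm_eq_abs]
  have := Eexp_nonneg t j
  unfold Eexp at *
  nlinarith

lemma G_bound {t : ℝ} (ht : 0 < t) (x y : ℝ) : |G t x y| ≤ 2 * t ^ (-(1/2 : ℝ)) := by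
  unfold G
  rw [← Real.norm_eq_abs]
  refine (tsum_of_norm_bounded ((Eexp_summable ht).hasSum.mul_left 2) (term_bound t x y)).trans ?_
  have := Eexp_tsum ht
  linarith

lemma G_cont {t : ℝ} (ht : 0 < t) (x : ℝ) : Continuous (G t x) := by
  unfold G
  refine continuous_tsum (fun j => ?_) ((Eexp_summable ht).mul_left 2) (fun j y => term_bound t x y j)
  unfold phiF
  fun_prop

/-- Neumann-type majorant. -/
noncomputable def Hterm (t x : ℝ) (j : ℕ) (y : ℝ) : ℝ :=
  Eexp t j * (2 * (Real.cos ((j + 1) * Real.pi * x) * Real.cos ((j + 1) * Real.pi * y)))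

lemma Hterm_bound (t x y : ℝ) (j : ℕ) : ‖Hterm t x j y‖ ≤ 2 * Eexp t j := by
  unfold Hterm
  rw [norm_mul, norm_mul, norm_mul, Real.norm_of_nonneg (Eexp_nonneg t j),
    Real.norm_of_nonneg (by norm_num : (0:ℝ) ≤ 2)]
  have h := mul_le_one₀ (Real.abs_cos_le_one (((j:ℝ)+1) * Real.pi * x)) (abs_nonneg _)
    (Real.abs_cos_le_one (((j:ℝ)+1) * Real.pi * y))
  simp only [Real.norm_eq_abs]
  have := Eexp_nonneg t j
  nlinarith

lemma Hterm_cont (t x : ℝ) (j : ℕ) : Continuous (Hterm t x j) := by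
  unfold Hterm
  fun_prop

noncomputable def Hf (t x y : ℝ) : ℝ := 1 + ∑' j, Hterm t x j y

lemma Hf_cont {t : ℝ} (ht : 0 < t) (x : ℝ) : Continuous (Hf t x) := by
  unfold Hf
  exact continuous_const.add (continuous_tsum (fun j => Hterm_cont t x j)
    ((Eexp_summable ht).mul_left 2) (fun j y => Hterm_bound t x y j))

lemma cosKernel_nonneg (a : ℝ) {t : ℝ} (ht : 0 < t) :
    0 ≤ HurwitzZeta.cosKernel (a : UnitAddCircle) t := by
  have h := HurwitzZeta.evenKernel_functional_equation (a : UnitAddCircle) (1 / t)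
  rw [one_div_one_div] at h
  have h2 : 0 ≤ HurwitzZeta.evenKernel (a : UnitAddCircle) (1 / t) :=
    (HurwitzZeta.hasSum_int_evenKernel a (by positivity : 0 < 1 / t)).nonneg
      (fun n => (Real.exp_pos _).le)
  rw [h] at h2
  exact nonneg_of_mul_nonneg_right h2 (by positivity)

lemma cos_series {t : ℝ} (ht : 0 < t) (u : ℝ) :
    HasSum (fun j : ℕ => Eexp t j * (2 * Real.cos ((j + 1) * Real.pi * u)))
      (HurwitzZeta.cosKernel ((u / 2 : ℝ) : UnitAddCircle) (Real.pi * t) - 1) := by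
  convert HurwitzZeta.hasSum_nat_cosKernel₀ (u / 2) (by positivity : 0 < Real.pi * t) using 1
  funext j
  unfold Eexp
  rw [mul_comm]
  congr 2
  · congr 1
    ring
  · ring

lemma abs_G_le {t : ℝ} (ht : 0 < t) (x y : ℝ) : |G t x y| ≤ Hf t x y := by
  have h1 := cos_series ht (x - y)
  have h2 := cos_series ht (x + y)
  have p1 := cosKernel_nonneg ((x - y) / 2) (by positivity : 0 < Real.pi * t)
  have p2 := cosKernel_nonneg ((x + y) / 2) (by positivity : 0 < Real.pi * t)
  set c1 := HurwitzZeta.cosKernel (((x - y) / 2 : ℝ) : UnitAddCircle) (Real.pi * t)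
  set c2 := HurwitzZeta.cosKernel (((x + y) / 2 : ℝ) : UnitAddCircle) (Real.pi * t)
  have hG : G t x y = (c1 - 1 - (c2 - 1)) * (1 / 2) := by
    refine HasSum.tsum_eq ?_
    have hh := (h1.sub h2).mul_right (1 / 2)
    refine Eq.mp (congrArg (fun f => HasSum f _) (funext fun j => ?_)) hh
    symm
    rw [mul_assoc, phiF_mul, mul_sub _ x y, mul_add _ x y, Real.cos_sub, Real.cos_add]
    push_cast
    unfold Eexp
    ring
  have hH : Hf t x y = 1 + (c1 - 1 + (c2 - 1)) * (1 / 2) := by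
    unfold Hf
    congr 1
    refine HasSum.tsum_eq ?_
    have hh := (h1.add h2).mul_right (1 / 2)
    refine Eq.mp (congrArg (fun f => HasSum f _) (funext fun j => ?_)) hh
    symm
    rw [mul_sub _ x y, mul_add _ x y, Real.cos_sub, Real.cos_add]
    unfold Hterm
    ring
  rw [hG, hH, abs_le]
  constructor <;> linarith

lemma Hf_integral {t : ℝ} (ht : 0 < t) (x : ℝ) : ∫ y in Set.Icc (0:ℝ) 1, Hf t x y = 1 := by
  rw [integral_Icc_eq_integral_Ioc, ← intervalIntegral.integral_of_le zero_le_one]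
  unfold Hf
  have hc : Continuous fun y => ∑' j, Hterm t x j y := continuous_tsum (fun j => Hterm_cont t x j)
    ((Eexp_summable ht).mul_left 2) (fun j y => Hterm_bound t x y j)
  rw [intervalIntegral.integral_add (by simp) (hc.intervalIntegrable _ _)]
  have h := intervalIntegral.hasSum_integral_of_dominated_convergence (μ := volume) (a := 0) (b := 1)
    (F := fun j y => Hterm t x j y) (f := fun y => ∑' j, Hterm t x j y)
    (fun j _ => 2 * Eexp t j) (fun j => (Hterm_cont t x j).aestronglyMeasurable)
    (fun j => Filter.Eventually.of_forall fun y _ => Hterm_bound t x y j)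
    (Filter.Eventually.of_forall fun y _ => (Eexp_summable ht).mul_left 2)
    (by simp)
    (Filter.Eventually.of_forall fun y _ => (Summable.of_norm_bounded
      ((Eexp_summable ht).mul_left 2) (fun j => Hterm_bound t x y j)).hasSum)
  have h0 : ∀ j, ∫ y in (0:ℝ)..1, Hterm t x j y = 0 := by
    intro j
    unfold Hterm
    have hj : ((j:ℝ) + 1) * Real.pi ≠ 0 := by positivity
    simp only [intervalIntegral.integral_const_mul]
    rw [intervalIntegral.integral_comp_mul_left (fun y => Real.cos y) hj, integral_cos]
    have := Real.sin_nat_mul_pi (j + 1)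
    push_cast at this
    simp [this]
  simp only [h0] at h
  rw [h.unique hasSum_zero]
  simp

lemma G_integral {t : ℝ} (ht : 0 < t) (x : ℝ) : ∫ y in Set.Icc (0:ℝ) 1, |G t x y| ≤ 1 := by
  refine le_trans ?_ (Hf_integral ht x).le
  have i1 : IntegrableOn (fun y => |G t x y|) (Set.Icc (0:ℝ) 1) volume :=
    (G_cont ht x).abs.continuousOn.integrableOn_compact isCompact_Icc
  have i2 : IntegrableOn (Hf t x) (Set.Icc (0:ℝ) 1) volume :=
    (Hf_cont ht x).continuousOn.integrableOn_compact isCompact_Icc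
  exact integral_mono i1 i2 (fun y => abs_G_le ht x y)

lemma Q_meas (d : ℕ) : MeasurableSet (Q d) := by
  have : Q d = ⋂ i, {x : EuclideanSpace ℝ (Fin d) | x i ∈ Set.Icc (0:ℝ) 1} := by
    ext x; simp [Q]
  rw [this]
  refine MeasurableSet.iInter fun i => ?_
  exact (by fun_prop : Measurable fun x : EuclideanSpace ℝ (Fin d) => x i) measurableSet_Icc

lemma Gd_cont (d : ℕ) {t : ℝ} (ht : 0 < t) (x : EuclideanSpace ℝ (Fin d)) :
    Continuous (Gd d t x) := by
  unfold Gd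
  refine continuous_finsetProd _ fun i _ => (G_cont ht (x i)).comp (by fun_prop)

lemma Gd_bound (d : ℕ) {t : ℝ} (ht : 0 < t) (x y : EuclideanSpace ℝ (Fin d)) :
    |Gd d t x y| ≤ 2 ^ d * t ^ (-(d / 2 : ℝ)) := by
  unfold Gd
  rw [Finset.abs_prod]
  refine (Finset.prod_le_prod (fun i _ => abs_nonneg _) (fun i _ => G_bound ht (x i) (y i))).trans ?_
  simp only [Finset.prod_const, Finset.card_univ, Fintype.card_fin]
  rw [mul_pow, ← Real.rpow_mul_natCast ht.le]
  apply le_of_eq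
  congr 2
  ring

lemma Q_preimage (d : ℕ) : (WithLp.toLp 2 : (Fin d → ℝ) → EuclideanSpace ℝ (Fin d)) ⁻¹' (Q d)
    = Set.univ.pi fun _ => Set.Icc (0:ℝ) 1 := by
  ext x; simp only [Q, Set.mem_pi, Set.mem_preimage, Set.mem_ofPred_eq, Set.mem_univ, forall_true_left]

lemma Q_finite (d : ℕ) : volume (Q d) < ⊤ := by
  rw [← (PiLp.volume_preserving_toLp (Fin d)).measure_preimage (Q_meas d).nullMeasurableSet,
    Q_preimage, volume_pi, Measure.pi_pi]
  simp

lemma Gd_integrable (d : ℕ) {t : ℝ} (ht : 0 < t) (x : EuclideanSpace ℝ (Fin d)) :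
    IntegrableOn (fun y => |Gd d t x y|) (Q d) := by
  refine Measure.integrableOn_of_bounded (M := 2 ^ d * t ^ (-(d / 2 : ℝ))) (Q_finite d).ne
    (Gd_cont d ht x).abs.aestronglyMeasurable (Filter.Eventually.of_forall fun y => ?_)
  simpa using Gd_bound d ht x y

lemma Gd_integral (d : ℕ) {t : ℝ} (ht : 0 < t) (x : EuclideanSpace ℝ (Fin d)) :
    ∫ y in Q d, |Gd d t x y| ≤ 1 := by
  rw [← (PiLp.volume_preserving_toLp (Fin d)).setIntegral_preimage_emb
    (MeasurableEquiv.toLp 2 (Fin d → ℝ)).measurableEmbedding, Q_preimage]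
  unfold Gd
  simp only [Finset.abs_prod]
  rw [volume_pi, Measure.restrict_pi_pi]
  rw [integral_fintype_prod_eq_prod (fun i y => |G t (x i) y|)]
  exact Finset.prod_le_one (fun i _ => integral_nonneg fun y => abs_nonneg _)
    (fun i _ => G_integral ht (x i))

/-- truncated Riesz kernel -/
noncomputable def trunc (α r : ℝ) (u : ℝ) : ℝ := (Set.Iio r).indicator (fun u => u ^ (-α)) u

lemma trunc_radial (d : ℕ) (hd : 1 ≤ d) (α r : ℝ) (hα : α < d) (hr : 0 < r) :
    IntegrableOn (fun y : ℝ => y ^ (d - 1) • trunc α r y) (Set.Ioi 0) ∧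
    ∫ y in Set.Ioi (0:ℝ), y ^ (d - 1) • trunc α r y = r ^ (d - α) / (d - α) := by
  have hs : ∀ y ∈ Set.Ioi (0:ℝ), y ^ (d - 1) • trunc α r y
      = (Set.Iio r).indicator (fun y => y ^ ((d:ℝ) - 1 - α)) y := by
    intro y hy
    have hy : 0 < y := hy
    unfold trunc
    by_cases h : y ∈ Set.Iio r
    · simp only [Set.indicator_of_mem h, smul_eq_mul]
      rw [← Real.rpow_natCast, ← Real.rpow_add hy]
      congr 1
      push_cast [Nat.cast_sub hd]
      ring
    · simp [Set.indicator_of_notMem h]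
  have hm : (-1:ℝ) < d - 1 - α := by linarith
  constructor
  · rw [integrableOn_congr_fun hs measurableSet_Ioi]
    rw [integrableOn_indicator_iff measurableSet_Iio]
    have := (intervalIntegral.intervalIntegrable_rpow' (a := 0) (b := r) hm)
    rw [intervalIntegrable_iff_integrableOn_Ioo_of_le hr.le] at this
    exact this.mono_set (fun y hy => ⟨hy.2, hy.1⟩)
  · rw [setIntegral_congr_fun measurableSet_Ioi hs, setIntegral_indicator measurableSet_Iio]
    have : Set.Ioi (0:ℝ) ∩ Set.Iio r = Set.Ioo 0 r := rfl
    rw [this, ← integral_Ioc_eq_integral_Ioo, ← intervalIntegral.integral_of_le hr.le,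
      integral_rpow (Or.inl hm)]
    have e : (d:ℝ) - 1 - α + 1 = d - α := by ring
    rw [e, Real.zero_rpow (by linarith), sub_zero]

lemma trunc_int (d : ℕ) (hd : 1 ≤ d) (α : ℝ) (hα : α < d) :
    ∃ c : ℝ, 0 ≤ c ∧ ∀ r : ℝ, 0 < r → ∀ y : EuclideanSpace ℝ (Fin d),
      Integrable (fun z => trunc α r ‖y - z‖) ∧
      ∫ z, trunc α r ‖y - z‖ = c * r ^ (d - α) := by
  have : Nonempty (Fin d) := ⟨⟨0, hd⟩⟩
  refine ⟨d * (volume.real (Metric.ball (0 : EuclideanSpace ℝ (Fin d)) 1)) / (d - α), ?_, ?_⟩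
  · have : 0 < d - α := by linarith
    positivity
  intro r hr y
  obtain ⟨h1, h2⟩ := trunc_radial d hd α r hα hr
  constructor
  · have : Integrable (fun z : EuclideanSpace ℝ (Fin d) => trunc α r ‖z‖) := by
      rw [integrable_fun_norm_addHaar volume (f := trunc α r)]
      simpa using h1
    exact this.comp_sub_left y
  · rw [integral_sub_left_eq_self (fun z : EuclideanSpace ℝ (Fin d) => trunc α r ‖z‖) volume y,
      integral_fun_norm_addHaar volume (trunc α r)]
    simp only [finrank_euclideanSpace, Fintype.card_fin]
    rw [h2]
    simp only [nsmul_eq_mul, smul_eq_mul]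
    ring

lemma norm_bound (d : ℕ) (hd : 1 ≤ d) (α : ℝ) (h0 : 0 < α) (hα : α < d) :
    ∃ K : ℝ, 0 < K ∧ ∀ t : ℝ, 0 < t → ∀ x : EuclideanSpace ℝ (Fin d),
      normAlphaSq d α (fun y => Gd d t x y) ≤ K * t ^ (-(α / 2)) := by
  obtain ⟨c, hc, H⟩ := trunc_int d hd α hα
  refine ⟨2 ^ d * c + 1, by positivity, fun t ht x => ?_⟩
  set r := t ^ (1 / 2 : ℝ) with hr
  have hr0 : 0 < r := by positivity
  set M := (2:ℝ) ^ d * t ^ (-(d / 2 : ℝ)) with hM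
  have hM0 : 0 < M := by positivity
  set K := (2 ^ d * c + 1) * t ^ (-(α / 2)) with hK
  have hrα : r ^ (-α) = t ^ (-(α / 2)) := by
    rw [hr, ← Real.rpow_mul ht.le]; congr 1; ring
  have hrd : M * (c * r ^ (d - α)) = 2 ^ d * c * t ^ (-(α / 2)) := by
    rw [hr, ← Real.rpow_mul ht.le, hM]
    have : t ^ (-(α / 2)) = t ^ (-(d / 2 : ℝ)) * t ^ (1 / 2 * (d - α)) := by
      rw [← Real.rpow_add ht]; congr 1; ring
    rw [this]; ring
  have inner : ∀ y, ∫ z in Q d, |Gd d t x y| * ‖y - z‖ ^ (-α) * |Gd d t x z|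
      ≤ |Gd d t x y| * K := by
    intro y
    obtain ⟨hi, hv⟩ := H r hr0 y
    simp only [mul_assoc]
    rw [integral_const_mul]
    refine mul_le_mul_of_nonneg_left ?_ (abs_nonneg _)
    have i1 : Integrable (fun z => M * trunc α r ‖y - z‖) (volume.restrict (Q d)) :=
      (hi.const_mul M).restrict
    have i2 : Integrable (fun z => r ^ (-α) * |Gd d t x z|) (volume.restrict (Q d)) :=
      (Gd_integrable d ht x).const_mul _
    have tn : ∀ u : ℝ, 0 ≤ u → 0 ≤ trunc α r u := fun u hu => by
      unfold trunc
      exact Set.indicator_apply_nonneg fun _ => Real.rpow_nonneg hu _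
    calc ∫ z in Q d, ‖y - z‖ ^ (-α) * |Gd d t x z|
        ≤ ∫ z in Q d, (M * trunc α r ‖y - z‖ + r ^ (-α) * |Gd d t x z|) := by
          refine integral_mono_of_nonneg (Filter.Eventually.of_forall fun z => ?_) (i1.add i2)
            (Filter.Eventually.of_forall fun z => ?_)
          · exact mul_nonneg (Real.rpow_nonneg (norm_nonneg _) _) (abs_nonneg _)
          · show ‖y - z‖ ^ (-α) * |Gd d t x z| ≤ M * trunc α r ‖y - z‖ + r ^ (-α) * |Gd d t x z|
            by_cases h : ‖y - z‖ < r
            · have e : trunc α r ‖y - z‖ = ‖y - z‖ ^ (-α) :=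
                Set.indicator_of_mem (Set.mem_Iio.mpr h) _
              rw [e]
              have b := Gd_bound d ht x z
              have b1 : 0 ≤ ‖y - z‖ ^ (-α) := Real.rpow_nonneg (norm_nonneg _) _
              have b2 : 0 ≤ r ^ (-α) * |Gd d t x z| := by positivity
              nlinarith
            · have h := not_lt.mp h
              have b := mul_le_mul_of_nonneg_right
                (Real.rpow_le_rpow_of_nonpos hr0 h (by linarith : -α ≤ 0)) (abs_nonneg (Gd d t x z))
              have := mul_nonneg hM0.le (tn _ (norm_nonneg (y - z)))
              linarith
      _ = M * (∫ z in Q d, trunc α r ‖y - z‖) + r ^ (-α) * ∫ z in Q d, |Gd d t x z| := by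
          rw [integral_add i1 i2, integral_const_mul, integral_const_mul]
      _ ≤ M * (c * r ^ (d - α)) + r ^ (-α) * 1 := by
          rw [← hv]
          have j1 : ∫ z in Q d, trunc α r ‖y - z‖ ≤ ∫ z, trunc α r ‖y - z‖ :=
            setIntegral_le_integral hi
              (Filter.Eventually.of_forall fun z => tn _ (norm_nonneg _))
          have j2 := Gd_integral d ht x
          have j3 : 0 ≤ r ^ (-α) := by positivity
          exact add_le_add (mul_le_mul_of_nonneg_left j1 hM0.le) (mul_le_mul_of_nonneg_left j2 j3)
      _ = K := by rw [hrd, hrα, hK]; ring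
  have hK0 : 0 ≤ K := by positivity
  unfold normAlphaSq
  calc _ ≤ ∫ y in Q d, |Gd d t x y| * K := by
        refine integral_mono_of_nonneg (Filter.Eventually.of_forall fun y => ?_)
          ((Gd_integrable d ht x).mul_const K) (Filter.Eventually.of_forall inner)
        exact integral_nonneg fun z => by positivity
    _ = (∫ y in Q d, |Gd d t x y|) * K := integral_mul_const _ _
    _ ≤ 1 * K := by gcongr; exact Gd_integral d ht x
    _ = K := one_mul K

/-- `∫_t^{t'} ‖G_d(t'-s,x,·)‖_{(α)}² ds ≤ C (t'-t)^{1-α/2}`. -/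
theorem stmt_6 (d : ℕ) (hd : 1 ≤ d) (α : ℝ) (hα : α ∈ Set.Ioo (0 : ℝ) (min 2 (d : ℝ))) :
    ∃ C : ℝ, 0 < C ∧ ∀ t t' : ℝ, 0 ≤ t → t ≤ t' → ∀ x ∈ Q d,
      (∫ s in t..t', normAlphaSq d α (fun y => Gd d (t' - s) x y))
        ≤ C * (t' - t) ^ (1 - α / 2) := by
  obtain ⟨h0, h1⟩ := hα
  have h2 : α < 2 := h1.trans_le (min_le_left _ _)
  have h3 : α < d := h1.trans_le (min_le_right _ _)
  obtain ⟨K, hK, H⟩ := norm_bound d hd α h0 h3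
  have h4 : 0 < 1 - α / 2 := by linarith
  refine ⟨K / (1 - α / 2), by positivity, fun t t' _ htt x _ => ?_⟩
  have hm : (-1:ℝ) < -(α / 2) := by linarith
  have hint : IntervalIntegrable (fun s => K * (t' - s) ^ (-(α / 2))) volume t t' := by
    have := ((intervalIntegral.intervalIntegrable_rpow' (a := t' - t) (b := 0) hm).comp_sub_left
      t').const_mul K
    simpa using this
  have hval : ∫ s in t..t', K * (t' - s) ^ (-(α / 2)) = K / (1 - α / 2) * (t' - t) ^ (1 - α / 2) := by
    rw [intervalIntegral.integral_const_mul,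
      intervalIntegral.integral_comp_sub_left (fun s => s ^ (-(α / 2))) t', sub_self,
      integral_rpow (Or.inl hm)]
    have e : -(α / 2) + 1 = 1 - α / 2 := by ring
    rw [e, Real.zero_rpow h4.ne', sub_zero]
    ring
  rw [← hval, intervalIntegral.integral_of_le htt, intervalIntegral.integral_of_le htt,
    integral_Ioc_eq_integral_Ioo, integral_Ioc_eq_integral_Ioo]
  refine integral_mono_of_nonneg (Filter.Eventually.of_forall fun s => ?_) ?_ ?_
  · exact integral_nonneg fun y => integral_nonneg fun z => by positivity
  · exact (intervalIntegrable_iff_integrableOn_Ioo_of_le htt).mp hint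
  · filter_upwards [ae_restrict_mem measurableSet_Ioo] with s hs
    exact H (t' - s) (by linarith [hs.2]) x
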